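/- arXiv:1908.06157 — 2 statements merged into one kernel-verified Lean document; each statement's English description precedes it below -/
import Mathlib

section
/- Suppose α = (α_1, …, α_n) ∈ ℝ^n is such that {α_1, …, α_n, 1} are linearly independent over ℚ and the form L_α is badly approximable. Then there are constants c, C > 0 depending only on α such that for every m ∈ ℤ⁺ the quantities β_1(m), …, β_ℓ(m) from the Minkowski algorithm satisfy c m^{-n} < |β_1(m)| < |β_2(m)| < ⋯ < |β_ℓ(m)| < C m^{-n}. -/
/-- ξ(r) = p + α₁q₁ + ⋯ + αₙqₙ for r = (q₁, …, qₙ, p) ∈ ℤ^(n+1). -/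
noncomputable def xi {n : ℕ} (α : Fin n → ℝ) (r : Fin (n + 1) → ℤ) : ℝ :=
  (r (Fin.last n) : ℝ) + ∑ i : Fin n, α i * (r (Fin.castSucc i) : ℝ)

/-- The real span of the rows of `A` preceding row `j`. -/
def earlierRowSpan {n : ℕ} (A : Matrix (Fin (n + 1)) (Fin (n + 1)) ℤ) (j : Fin (n + 1)) :
    Submodule ℝ (Fin (n + 1) → ℝ) :=
  Submodule.span ℝ {x : Fin (n + 1) → ℝ | ∃ i : Fin (n + 1), i < j ∧ x = fun k => (A i k : ℝ)}

/-- `A` is the matrix produced by the Minkowski algorithm at stage `m`: each row has sup norm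
at most `m`, is linearly independent of the previous rows, minimizes `|ξ|` among all integer
vectors with sup norm at most `m` that are linearly independent of the previous rows, and its
first nonzero entry is positive. -/
def IsMinkowskiMatrix {n : ℕ} (α : Fin n → ℝ) (m : ℕ)
    (A : Matrix (Fin (n + 1)) (Fin (n + 1)) ℤ) : Prop :=
  ∀ j : Fin (n + 1),
    (∀ k, |A j k| ≤ (m : ℤ)) ∧
    (fun k => (A j k : ℝ)) ∉ earlierRowSpan A j ∧
    (∀ w : Fin (n + 1) → ℤ, (∀ k, |w k| ≤ (m : ℤ)) →
      ((fun k => (w k : ℝ)) ∉ earlierRowSpan A j) → |xi α (A j)| ≤ |xi α w|) ∧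
    (∃ k₀ : Fin (n + 1), 0 < A j k₀ ∧ ∀ k < k₀, A j k = 0)

/-- `B` (indexed from 0, so `B 0 = B₁`) is the Minkowski chain of `α`: the subsequence of
distinct matrices among the matrices `A m` produced by the Minkowski algorithm, starting
with `A 1`. -/
def IsMinkowskiChain {n : ℕ} (α : Fin n → ℝ)
    (B : ℕ → Matrix (Fin (n + 1)) (Fin (n + 1)) ℤ) : Prop :=
  ∃ (A : ℕ → Matrix (Fin (n + 1)) (Fin (n + 1)) ℤ) (idx : ℕ → ℕ),
    (∀ m, 1 ≤ m → IsMinkowskiMatrix α m (A m)) ∧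
    StrictMono idx ∧ idx 0 = 1 ∧
    (∀ k, B k = A (idx k)) ∧
    (∀ k m, idx k ≤ m → m < idx (k + 1) → A m = A (idx k)) ∧
    (∀ k, A (idx (k + 1)) ≠ A (idx k))
/-- The distance from a real number to the nearest integer. -/
noncomputable def distNearestInt (t : ℝ) : ℝ := |t - round t|

/-- The linear form L_α(q) = α₁q₁ + ⋯ + αₙqₙ. -/
noncomputable def Lform {n : ℕ} (α : Fin n → ℝ) (q : Fin n → ℤ) : ℝ :=
  ∑ i, α i * (q i : ℝ)

/-- The sup norm of an integer vector. -/
def intSupNorm {n : ℕ} (q : Fin n → ℤ) : ℕ := Finset.univ.sup fun i => (q i).natAbs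

/-- The form L_α is badly approximable: there is `c > 0` with
`‖L_α(q)‖ ≥ c ‖q‖_∞^{-n}` for all nonzero integer vectors `q`. -/
def BadlyApprox {n : ℕ} (α : Fin n → ℝ) : Prop :=
  ∃ c > (0 : ℝ), ∀ q : Fin n → ℤ, q ≠ 0 →
    c / (intSupNorm q : ℝ) ^ n ≤ distNearestInt (Lform α q)

/-- The form L_α is singular: for every `ε > 0` and all sufficiently large integers `Q`
there is a nonzero `q ∈ ℤⁿ` with `‖q‖_∞ ≤ Q` and `‖L_α(q)‖ ≤ ε Q^{-n}`. -/
def Singular {n : ℕ} (α : Fin n → ℝ) : Prop :=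
  ∀ ε > (0 : ℝ), ∃ Q₀ : ℕ, ∀ Q : ℕ, Q₀ ≤ Q → ∃ q : Fin n → ℤ, q ≠ 0 ∧
    (intSupNorm q : ℝ) ≤ (Q : ℝ) ∧ distNearestInt (Lform α q) ≤ ε / (Q : ℝ) ^ n

lemma intSupNorm_le_iff {n : ℕ} (q : Fin n → ℤ) (M : ℕ) :
    intSupNorm q ≤ M ↔ ∀ i, |q i| ≤ (M : ℤ) := by
  simp only [intSupNorm, Finset.sup_le_iff, Finset.mem_univ, true_implies]
  refine forall_congr' fun i => ?_
  rw [Int.abs_eq_natAbs]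
  norm_cast

lemma intSupNorm_pos {n : ℕ} {q : Fin n → ℤ} (hq : q ≠ 0) : 0 < intSupNorm q := by
  by_contra! h
  refine hq (funext fun i => ?_)
  simpa using (intSupNorm_le_iff q 0).1 h i

lemma distNearestInt_le_abs_add (t : ℝ) (p : ℤ) : distNearestInt t ≤ |t + p| := by
  simpa [distNearestInt] using round_le t (-p)

lemma le_abs_Lform_add {n : ℕ} {α : Fin n → ℝ} {c : ℝ} (hc : 0 < c)
    (hba : ∀ q : Fin n → ℤ, q ≠ 0 → c / (intSupNorm q : ℝ) ^ n ≤ distNearestInt (Lform α q))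
    {M : ℕ} {q : Fin n → ℤ} (hq : q ≠ 0) (hqM : ∀ i, |q i| ≤ (M : ℤ)) (p : ℤ) :
    c / (M : ℝ) ^ n ≤ |Lform α q + p| := by
  have hpos : (0 : ℝ) < intSupNorm q := by exact_mod_cast intSupNorm_pos hq
  have hle : (intSupNorm q : ℝ) ≤ M := by exact_mod_cast (intSupNorm_le_iff q M).2 hqM
  calc c / (M : ℝ) ^ n ≤ c / (intSupNorm q : ℝ) ^ n := by gcongr
    _ ≤ _ := (hba q hq).trans (distNearestInt_le_abs_add _ p)

lemma xi_eq_Lform_add {n : ℕ} (α : Fin n → ℝ) (r : Fin (n + 1) → ℤ) :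
    xi α r = Lform α (fun i => r i.castSucc) + (r (Fin.last n) : ℤ) := by
  simp [xi, Lform, add_comm]

/-- Two reals whose fractional parts lie in the same of `B` equal bins differ by an integer up to
an error less than `1 / B`. -/
lemma abs_sub_sub_floor_lt {B : ℕ} (hB : 0 < B) {s t : ℝ}
    (h : ⌊Int.fract s * B⌋₊ = ⌊Int.fract t * B⌋₊) :
    |s - t + ((⌊t⌋ - ⌊s⌋ : ℤ) : ℝ)| < 1 / B := by
  have hB' : (0 : ℝ) < B := by exact_mod_cast hB
  have hs0 : 0 ≤ Int.fract s * B := mul_nonneg (Int.fract_nonneg s) hB'.le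
  have ht0 : 0 ≤ Int.fract t * B := mul_nonneg (Int.fract_nonneg t) hB'.le
  have h1 := Nat.floor_le hs0
  have h2 := Nat.lt_floor_add_one (Int.fract s * B)
  have h3 := Nat.floor_le ht0
  have h4 := Nat.lt_floor_add_one (Int.fract t * B)
  rw [h] at h1 h2
  have e : s - t + ((⌊t⌋ - ⌊s⌋ : ℤ) : ℝ) = Int.fract s - Int.fract t := by
    push_cast [Int.fract]; ring
  rw [e, abs_lt, lt_div_iff₀ hB', neg_lt, lt_div_iff₀ hB']
  constructor <;> linarith

/-- If the parallelepiped `‖q‖_∞ ≤ M`, `|L_α(q) + p| < 1 / (k M ^ n)` contains no integer points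
with `q ≠ 0`, then a dilate of it by a factor depending only on `k` contains an integer point off
any given hyperplane. -/
lemma exists_small_off_hyperplane {n : ℕ} (hn : 1 ≤ n) {α : Fin n → ℝ} {k M : ℕ} (hk : 0 < k)
    (hM : 0 < M)
    (hsep : ∀ (q : Fin n → ℤ) (p : ℤ), q ≠ 0 → (∀ i, |q i| ≤ (M : ℤ)) →
      1 / ((k * M ^ n : ℕ) : ℝ) ≤ |Lform α q + p|)
    (b : Fin n → ℝ) (d : ℝ) (hbd : b ≠ 0 ∨ d ≠ 0) :
    ∃ (q : Fin n → ℤ) (p : ℤ), (∀ i, |q i| ≤ (2 * k * M : ℤ)) ∧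
      |Lform α q + p| ≤ 2 / (M : ℝ) ^ n ∧ ∑ i, b i * q i + d * (Lform α q + p) ≠ 0 := by
  obtain ⟨s, hs, hbs⟩ : ∃ s : Fin n → ℤ, (∀ i, |s i| = 1) ∧ ∀ i, b i * s i = |b i| := by
    refine ⟨fun i => if 0 ≤ b i then 1 else -1, fun i => ?_, fun i => ?_⟩ <;> dsimp only <;>
      split_ifs with h
    · simp
    · simp
    · simp [abs_of_nonneg h]
    · simp [abs_of_neg (not_le.1 h)]
  obtain ⟨σ, hσ, hdσ⟩ : ∃ σ : ℝ, |σ| = 1 ∧ d * σ = |d| := by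
    rcases le_total 0 d with h | h
    · exact ⟨1, by simp, by simp [abs_of_nonneg h]⟩
    · exact ⟨-1, by simp, by simp [abs_of_nonpos h]⟩
  set B : ℕ := k * M ^ n with hBdef
  have hB : 0 < B := by positivity
  have hB' : (0 : ℝ) < B := by exact_mod_cast hB
  let Q : Fin k × (Fin n → Fin (M + 1)) → Fin n → ℤ :=
    fun x i => 2 * (x.1 : ℤ) * M * s i + (x.2 i : ℤ)
  let t : Fin k × (Fin n → Fin (M + 1)) → ℝ := fun x => Lform α (Q x) - 2 * (x.1 : ℝ) * σ / B
  obtain ⟨x, -, y, -, hxy, hbin⟩ : ∃ x ∈ Finset.univ, ∃ y ∈ Finset.univ, x ≠ y ∧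
      ⌊Int.fract (t x) * B⌋₊ = ⌊Int.fract (t y) * B⌋₊ := by
    refine Finset.exists_ne_map_eq_of_card_lt_of_maps_to (t := Finset.range B) ?_ ?_
    · simp only [Finset.card_range, Finset.card_univ, Fintype.card_prod, Fintype.card_fin,
        Fintype.card_fun, hBdef]
      exact Nat.mul_lt_mul_of_pos_left (Nat.pow_lt_pow_left (Nat.lt_succ_self M) (by omega)) hk
    · intro x _
      simp only [Finset.coe_range, Set.mem_Iio]
      rw [Nat.floor_lt (mul_nonneg (Int.fract_nonneg _) hB'.le)]
      exact mul_lt_of_lt_one_left hB' (Int.fract_lt_one _)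
  have he := abs_sub_sub_floor_lt hB hbin
  set p : ℤ := ⌊t y⌋ - ⌊t x⌋
  set e : ℝ := t x - t y + (p : ℝ) with he_def
  set D : ℤ := (x.1 : ℤ) - (y.1 : ℤ) with hD
  have hDk : |D| ≤ k - 1 := by
    have := x.1.2; have := y.1.2
    rw [abs_le]; omega
  let v : Fin n → ℤ := fun i => (x.2 i : ℤ) - (y.2 i : ℤ)
  have hv : ∀ i, |v i| ≤ (M : ℤ) := by
    intro i
    have := (x.2 i).2; have := (y.2 i).2
    simp only [v]
    rw [abs_le]; omega
  have hq : ∀ i, (Q x - Q y) i = 2 * D * M * s i + v i := by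
    intro i; simp only [Q, v, hD, Pi.sub_apply]; ring
  have hLsub : Lform α (Q x - Q y) = Lform α (Q x) - Lform α (Q y) := by
    simp [Lform, mul_sub]
  have hxi : Lform α (Q x - Q y) + p = 2 * D * σ / B + e := by
    rw [hLsub, he_def]; simp only [t, hD]; push_cast; ring
  have hD0 : D ≠ 0 := by
    intro h0
    have hq0 : Q x - Q y ≠ 0 := by
      intro h
      refine hxy (Prod.ext (Fin.ext (by omega)) (funext fun i => Fin.ext ?_))
      have := hq i
      simp only [h, h0, Pi.zero_apply, v] at this
      simp at this
      omega
    have := hsep (Q x - Q y) p hq0 (fun i => by rw [hq, h0]; simpa using hv i)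
    rw [hxi, h0] at this
    simp only [Int.cast_zero, mul_zero, zero_mul, zero_div, zero_add] at this
    exact absurd he (not_lt.2 this)
  have hDR : (1 : ℝ) ≤ |(D : ℝ)| := by exact_mod_cast Int.one_le_abs hD0
  have hDkR : |(D : ℝ)| ≤ k - 1 := by exact_mod_cast hDk
  refine ⟨Q x - Q y, p, fun i => ?_, ?_, ?_⟩
  · rw [hq]
    calc |2 * D * M * s i + v i| ≤ |2 * D * M * s i| + |v i| := abs_add_le _ _
      _ = 2 * |D| * M + |v i| := by simp [abs_mul, hs]
      _ ≤ 2 * (k - 1) * M + M := by gcongr; exact hv i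
      _ ≤ 2 * k * M := by nlinarith
  · rw [hxi]
    calc |2 * D * σ / B + e| ≤ |2 * D * σ / B| + |e| := abs_add_le _ _
      _ = 2 * |(D : ℝ)| / B + |e| := by simp [abs_mul, abs_div, hσ]
      _ ≤ 2 * (k - 1) / B + 1 / B := by gcongr
      _ ≤ 2 * k / B := by rw [← add_div]; gcongr; linarith
      _ = 2 / (M : ℝ) ^ n := by
        rw [hBdef]; push_cast; field_simp
  · set U : ℝ := (∑ i, |b i|) * M + |d| / B with hU
    have hU0 : 0 < U := by
      have hMR : (0 : ℝ) < M := by exact_mod_cast hM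
      have hsum : 0 ≤ ∑ i, |b i| := Finset.sum_nonneg fun i _ => abs_nonneg _
      rcases hbd with h | h
      · obtain ⟨i, hi⟩ := Function.ne_iff.1 h
        have : 0 < ∑ i, |b i| :=
          Finset.sum_pos' (fun i _ => abs_nonneg _) ⟨i, Finset.mem_univ i, abs_pos.2 hi⟩
        positivity
      · have := abs_pos.2 h
        positivity
    have hrem : |∑ i, b i * v i + d * e| ≤ U := by
      calc |∑ i, b i * v i + d * e| ≤ |∑ i, b i * v i| + |d * e| := abs_add_le _ _
        _ ≤ ∑ i, |b i * v i| + |d * e| := by gcongr; exact Finset.abs_sum_le_sum_abs _ _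
        _ = ∑ i, |b i| * |(v i : ℝ)| + |d| * |e| := by simp only [abs_mul]
        _ ≤ ∑ i, |b i| * M + |d| * (1 / B) := by
          gcongr with i
          exact_mod_cast hv i
        _ = U := by rw [hU, Finset.sum_mul]; ring
    have hval : ∑ i, b i * ((Q x - Q y) i : ℝ) + d * (Lform α (Q x - Q y) + p) =
        2 * D * U + (∑ i, b i * v i + d * e) := by
      have h1 : ∀ i, b i * ((Q x - Q y) i : ℝ) = |b i| * (2 * D * M) + b i * v i := by
        intro i; rw [hq, ← hbs]; push_cast; ring
      rw [Finset.sum_congr rfl fun i _ => h1 i, Finset.sum_add_distrib, ← Finset.sum_mul, hxi, hU,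
        ← hdσ]
      ring
    rw [hval]
    intro h
    have : |2 * D * U| ≤ U := by
      rw [eq_neg_of_add_eq_zero_left h, abs_neg]; exact hrem
    rw [abs_mul, abs_mul, abs_of_pos hU0, abs_two] at this
    nlinarith

lemma xi_sub {n : ℕ} (α : Fin n → ℝ) (v w : Fin (n + 1) → ℤ) :
    xi α (v - w) = xi α v - xi α w := by
  simp [xi, mul_sub]; ring

lemma xi_neg {n : ℕ} (α : Fin n → ℝ) (w : Fin (n + 1) → ℤ) : xi α (-w) = -xi α w := by
  simp [xi]; ring

lemma eq_zero_of_xi_eq_zero {n : ℕ} {α : Fin n → ℝ}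
    (hind : LinearIndependent ℚ (Fin.snoc α 1 : Fin (n + 1) → ℝ)) {w : Fin (n + 1) → ℤ}
    (h : xi α w = 0) : w = 0 := by
  funext k
  have := Fintype.linearIndependent_iff.1 hind (fun k => (w k : ℚ)) (by
    rw [Fin.sum_univ_castSucc]
    simp only [Fin.snoc_castSucc, Fin.snoc_last, Rat.smul_def, Rat.cast_intCast]
    rw [← h, xi, add_comm]
    simp [mul_comm]) k
  exact_mod_cast this

/-- A vector outside a subspace is separated from it by a linear functional, written in the
coordinates `(q, ξ)`. -/
lemma exists_coeffs_of_notMem {n : ℕ} (α : Fin n → ℝ) {V : Submodule ℝ (Fin (n + 1) → ℝ)}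
    {x : Fin (n + 1) → ℝ} (hx : x ∉ V) :
    ∃ (b : Fin n → ℝ) (d : ℝ), (b ≠ 0 ∨ d ≠ 0) ∧ ∀ w : Fin (n + 1) → ℤ,
      ∑ i, b i * w i.castSucc + d * xi α w ≠ 0 → (fun k => (w k : ℝ)) ∉ V := by
  obtain ⟨f, hfx, hf⟩ := Submodule.exists_le_ker_of_notMem hx
  have hsum : ∀ y, f y = ∑ k, y k * f (Pi.single k 1) := fun y => by
    conv_lhs => rw [← Finset.univ_sum_single y]
    rw [map_sum]
    refine Finset.sum_congr rfl fun k _ => ?_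
    rw [← smul_eq_mul, ← map_smul, ← Pi.single_smul]
    simp
  set a : Fin (n + 1) → ℝ := fun k => f (Pi.single k 1)
  refine ⟨fun i => a i.castSucc - a (Fin.last n) * α i, a (Fin.last n), ?_, ?_⟩
  · by_contra! h
    refine hfx ?_
    rw [hsum]
    refine Finset.sum_eq_zero fun k _ => mul_eq_zero_of_right _ ?_
    induction k using Fin.lastCases with
    | last => exact h.2
    | cast i => simpa [h.2] using congrFun h.1 i
  · intro w hw hmem
    refine hw ?_
    have h0 : f (fun k => (w k : ℝ)) = 0 := hf hmem
    rw [hsum, Fin.sum_univ_castSucc] at h0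
    rw [← h0, xi, mul_add, Finset.mul_sum, add_left_comm, ← Finset.sum_add_distrib, add_comm]
    congr 1
    · exact Finset.sum_congr rfl fun i _ => by ring
    · ring

namespace IsMinkowskiMatrix

variable {n m : ℕ} {α : Fin n → ℝ} {A : Matrix (Fin (n + 1)) (Fin (n + 1)) ℤ}

lemma row_ne_zero (hA : IsMinkowskiMatrix α m A) (j : Fin (n + 1)) : A j ≠ 0 := by
  intro h
  refine (hA j).2.1 ?_
  rw [h]
  convert (earlierRowSpan A j).zero_mem using 1
  funext k
  simp

lemma abs_xi_lt (hA : IsMinkowskiMatrix α m A)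
    (hind : LinearIndependent ℚ (Fin.snoc α 1 : Fin (n + 1) → ℝ)) {i j : Fin (n + 1)}
    (hij : i < j) : |xi α (A i)| < |xi α (A j)| := by
  have hmono : earlierRowSpan A i ≤ earlierRowSpan A j :=
    Submodule.span_mono fun x ⟨l, hl, hx⟩ => ⟨l, hl.trans hij, hx⟩
  have hmem : (fun k => (A i k : ℝ)) ∈ earlierRowSpan A j :=
    Submodule.subset_span ⟨i, hij, rfl⟩
  refine lt_of_le_of_ne ((hA i).2.2.1 (A j) (hA j).1 fun h => (hA j).2.1 (hmono h)) fun h => ?_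
  rcases abs_eq_abs.1 h with h | h
  · have : A i = A j := sub_eq_zero.1 (eq_zero_of_xi_eq_zero hind (by rw [xi_sub, h, sub_self]))
    exact (hA j).2.1 (this ▸ hmem)
  · have : A i = -A j := sub_eq_zero.1
      (eq_zero_of_xi_eq_zero hind (by rw [xi_sub, xi_neg, h, sub_self]))
    refine (hA j).2.1 ?_
    convert (earlierRowSpan A j).neg_mem hmem using 1
    funext k
    simp [this]

lemma le_abs_xi (hA : IsMinkowskiMatrix α m A) (hm : 1 ≤ m) {c : ℝ} (hc : 0 < c)
    (hba : ∀ q : Fin n → ℤ, q ≠ 0 → c / (intSupNorm q : ℝ) ^ n ≤ distNearestInt (Lform α q))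
    (j : Fin (n + 1)) : min c 1 / (m : ℝ) ^ n ≤ |xi α (A j)| := by
  have hm' : (1 : ℝ) ≤ m := by exact_mod_cast hm
  rw [xi_eq_Lform_add]
  by_cases hq : (fun i : Fin n => A j i.castSucc) = 0
  · have hp : A j (Fin.last n) ≠ 0 := fun hp => hA.row_ne_zero j <| funext fun k => by
      induction k using Fin.lastCases with
      | last => exact hp
      | cast i => exact congrFun hq i
    have h1 : (1 : ℝ) ≤ |(A j (Fin.last n) : ℝ)| := by exact_mod_cast Int.one_le_abs hp
    rw [hq]
    calc min c 1 / (m : ℝ) ^ n ≤ 1 := by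
          rw [div_le_one (by positivity)]
          exact (min_le_right _ _).trans (one_le_pow₀ hm')
      _ ≤ _ := by simpa [Lform] using h1
  · refine le_trans ?_ (le_abs_Lform_add hc hba hq (fun i => (hA j).1 _) _)
    gcongr
    exact min_le_left _ _

lemma abs_xi_le_one_add (hA : IsMinkowskiMatrix α m A) (hm : 1 ≤ m) (j : Fin (n + 1)) :
    |xi α (A j)| ≤ 1 + ∑ i, |α i| := by
  obtain ⟨l, hl⟩ : ∃ l : Fin (n + 1),
      (fun k => ((Pi.single l 1 : Fin (n + 1) → ℤ) k : ℝ)) ∉ earlierRowSpan A j := by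
    by_contra! h
    refine (hA j).2.1 ?_
    have hrow : (fun k => (A j k : ℝ)) =
        ∑ l, (A j l : ℝ) • fun k => ((Pi.single l 1 : Fin (n + 1) → ℤ) k : ℝ) := by
      funext k
      simp [Finset.sum_apply, Pi.single_apply]
    rw [hrow]
    exact Submodule.sum_mem _ fun l _ => Submodule.smul_mem _ _ (h l)
  have hle : ∀ k, |(Pi.single l 1 : Fin (n + 1) → ℤ) k| ≤ 1 := by
    intro k
    rw [Pi.single_apply]
    split_ifs <;> simp
  refine ((hA j).2.2.1 _ (fun k => (hle k).trans (by exact_mod_cast hm)) hl).trans ?_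
  have hleR : ∀ k, |((Pi.single l 1 : Fin (n + 1) → ℤ) k : ℝ)| ≤ 1 := fun k => by
    exact_mod_cast hle k
  refine (abs_add_le _ _).trans (add_le_add (hleR _) ?_)
  refine (Finset.abs_sum_le_sum_abs _ _).trans (Finset.sum_le_sum fun i _ => ?_)
  rw [abs_mul]
  exact mul_le_of_le_one_right (abs_nonneg _) (hleR _)

lemma abs_xi_le_two_div (hA : IsMinkowskiMatrix α m A) (hn : 1 ≤ n) {k M : ℕ} (hk : 0 < k)
    (hM : 0 < M)
    (hsep : ∀ (q : Fin n → ℤ) (p : ℤ), q ≠ 0 → (∀ i, |q i| ≤ (M : ℤ)) →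
      1 / ((k * M ^ n : ℕ) : ℝ) ≤ |Lform α q + p|)
    (hMm : (2 * k * (1 + ∑ i, |α i|) + 2) * M ≤ m) (j : Fin (n + 1)) :
    |xi α (A j)| ≤ 2 / (M : ℝ) ^ n := by
  obtain ⟨b, d, hbd, hV⟩ := exists_coeffs_of_notMem α (hA j).2.1
  obtain ⟨q, p, hq, hξ, hne⟩ := exists_small_off_hyperplane hn hk hM hsep b d hbd
  have hM1 : (1 : ℝ) ≤ M := by exact_mod_cast hM
  have hS : 0 ≤ ∑ i, |α i| := Finset.sum_nonneg fun i _ => abs_nonneg _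
  have hw : xi α (Fin.snoc q p : Fin (n + 1) → ℤ) = Lform α q + p := by
    simp [xi_eq_Lform_add]
  have hqR : ∀ i, |(q i : ℝ)| ≤ 2 * k * M := fun i => by exact_mod_cast hq i
  have hkM : (0 : ℝ) ≤ k * M := by positivity
  refine ((hA j).2.2.1 (Fin.snoc q p) (fun l => ?_) (hV _ ?_)).trans (hw ▸ hξ)
  · suffices |((Fin.snoc q p : Fin (n + 1) → ℤ) l : ℝ)| ≤ m by exact_mod_cast this
    induction l using Fin.lastCases with
    | cast i =>
      simp only [Fin.snoc_castSucc]
      refine (hqR i).trans (le_trans ?_ hMm)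
      nlinarith [mul_nonneg hkM hS]
    | last =>
      simp only [Fin.snoc_last]
      have hL : |Lform α q| ≤ (∑ i, |α i|) * (2 * k * M) := by
        rw [Finset.sum_mul]
        refine (Finset.abs_sum_le_sum_abs _ _).trans (Finset.sum_le_sum fun i _ => ?_)
        rw [abs_mul]
        exact mul_le_mul_of_nonneg_left (hqR i) (abs_nonneg _)
      have h2 : 2 / (M : ℝ) ^ n ≤ 2 := div_le_self (by norm_num) (one_le_pow₀ hM1)
      have h3 : |(p : ℝ)| ≤ |Lform α q + p| + |Lform α q| := by
        simpa using abs_sub (Lform α q + p) (Lform α q)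
      refine le_trans ?_ hMm
      nlinarith
  · simpa [hw] using hne

end IsMinkowskiMatrix

/-- Suppose `{α₁, …, αₙ, 1}` are linearly independent over `ℚ` and `L_α` is badly
approximable. Then there are constants `c, C > 0` depending only on `α` such that for
every `m ≥ 1` the quantities `β_j(m) = ξ(j-th row of A_m)` from the Minkowski algorithm
satisfy `c m^{-n} < |β₁(m)| < ⋯ < |β_ℓ(m)| < C m^{-n}`. -/
theorem badlyApprox_beta_bounds {n : ℕ} (hn : 1 ≤ n) (α : Fin n → ℝ)
    (hind : LinearIndependent ℚ (Fin.snoc α 1 : Fin (n + 1) → ℝ))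
    (hba : BadlyApprox α) :
    ∃ c > (0 : ℝ), ∃ C > (0 : ℝ), ∀ m : ℕ, 1 ≤ m →
      ∀ A : Matrix (Fin (n + 1)) (Fin (n + 1)) ℤ, IsMinkowskiMatrix α m A →
        c / (m : ℝ) ^ n < |xi α (A 0)| ∧
        (∀ i j : Fin (n + 1), i < j → |xi α (A i)| < |xi α (A j)|) ∧
        |xi α (A (Fin.last n))| < C / (m : ℝ) ^ n := by
  obtain ⟨c, hc, hba⟩ := hba
  obtain ⟨k, hk⟩ := exists_nat_gt (1 / c)
  have hkR : (0 : ℝ) < k := lt_trans (by positivity) hk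
  have hk0 : 0 < k := by exact_mod_cast hkR
  have hS : 0 ≤ ∑ i, |α i| := Finset.sum_nonneg fun i _ => abs_nonneg _
  obtain ⟨R, hR⟩ := exists_nat_ge (2 * k * (1 + ∑ i, |α i|) + 2)
  have hR0 : (0 : ℝ) < R := lt_of_lt_of_le (by positivity) hR
  have hR0' : 0 < R := by exact_mod_cast hR0
  have hsep : ∀ M : ℕ, 0 < M → ∀ (q : Fin n → ℤ) (p : ℤ), q ≠ 0 → (∀ i, |q i| ≤ (M : ℤ)) →
      1 / ((k * M ^ n : ℕ) : ℝ) ≤ |Lform α q + p| := by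
    intro M hM q p hq hqM
    refine le_trans ?_ (le_abs_Lform_add hc hba hq hqM p)
    have hMn : (0 : ℝ) < (M : ℝ) ^ n := by positivity
    push_cast
    rw [← div_div]
    gcongr
    exact (div_le_comm₀ hkR hc).2 hk.le
  refine ⟨min c 1 / 2, by positivity, 2 * (2 * R) ^ n + (1 + ∑ i, |α i|) * R ^ n + 1,
    by positivity, fun m hm A hA => ⟨?_, fun i j hij => hA.abs_xi_lt hind hij, ?_⟩⟩
  · refine lt_of_lt_of_le ?_ (hA.le_abs_xi hm hc hba 0)
    have hmin : 0 < min c 1 := by positivity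
    gcongr
    linarith
  · have hm0 : (0 : ℝ) < m := by exact_mod_cast hm
    rw [lt_div_iff₀ (by positivity)]
    rcases lt_or_ge m R with hmR | hmR
    · have hmR' : (m : ℝ) ≤ R := by exact_mod_cast hmR.le
      have h1 : |xi α (A (Fin.last n))| * (m : ℝ) ^ n ≤ (1 + ∑ i, |α i|) * R ^ n := by
        gcongr
        exact hA.abs_xi_le_one_add hm _
      have h2 : (0 : ℝ) ≤ 2 * (2 * R) ^ n := by positivity
      linarith
    · have hM : 0 < m / R := Nat.div_pos hmR hR0'
      have hMR : (0 : ℝ) < ((m / R : ℕ) : ℝ) := by exact_mod_cast hM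
      have hle : (R : ℝ) * ((m / R : ℕ) : ℝ) ≤ m := by exact_mod_cast Nat.mul_div_le m R
      have hge : (m : ℝ) ≤ 2 * R * ((m / R : ℕ) : ℝ) := by
        have h : m ≤ 2 * R * (m / R) := by
          have h1 := Nat.lt_mul_div_succ m hR0'
          nlinarith
        exact_mod_cast h
      have h1 : |xi α (A (Fin.last n))| * (m : ℝ) ^ n ≤ 2 * (2 * R) ^ n := by
        calc |xi α (A (Fin.last n))| * (m : ℝ) ^ n
            ≤ 2 / ((m / R : ℕ) : ℝ) ^ n * (2 * R * ((m / R : ℕ) : ℝ)) ^ n := by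
              gcongr
              exact hA.abs_xi_le_two_div hn hk0 hM (hsep _ hM)
                ((mul_le_mul_of_nonneg_right hR hMR.le).trans hle) _
          _ = 2 * (2 * R) ^ n := by
              rw [mul_pow _ ((m / R : ℕ) : ℝ)]
              field_simp
      have h2 : (0 : ℝ) ≤ (1 + ∑ i, |α i|) * R ^ n := by positivity
      linarith
end

section
/- Let F be a norm on ℝ^ℓ, Λ ⊂ ℝ^ℓ a full-rank lattice, and v_1, …, v_ℓ a reduced basis of Λ with respect to F with λ_i = F(v_i), so that λ_1 ≤ λ_2 ≤ ⋯ ≤ λ_ℓ. If w_1, …, w_ℓ ∈ Λ are linearly independent minimizing vectors for the successive minima, i.e. F(w_j) = μ_j where μ_1 ≤ μ_2 ≤ ⋯ ≤ μ_ℓ are the successive minima of Λ with respect to F, then λ_1 = μ_1 and λ_k ≤ (3/2)^{k-2} μ_k for each k = 2, …, ℓ. -/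
/-- `F` is a norm on `ℝ^ℓ`. -/
def IsNorm {l : ℕ} (F : (Fin l → ℝ) → ℝ) : Prop :=
  (∀ x, 0 ≤ F x) ∧ (∀ x, F x = 0 ↔ x = 0) ∧
    (∀ (a : ℝ) (x), F (a • x) = |a| * F x) ∧ ∀ x y, F (x + y) ≤ F x + F y

/-- `v₁, …, v_ℓ` is an ordered `ℤ`-basis of the full-rank lattice `Λ ⊆ ℝ^ℓ`. -/
def IsZBasisOf {l : ℕ} (v : Fin l → Fin l → ℝ) (Λ : Set (Fin l → ℝ)) : Prop :=
  LinearIndependent ℝ v ∧ Λ = {x | ∃ a : Fin l → ℤ, x = ∑ i, (a i : ℝ) • v i}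

/-- For an ordered basis `v` of a lattice, `Rset v k` is the set of lattice vectors
`a₁v₁ + ⋯ + a_ℓv_ℓ` with `gcd(a_k, a_{k+1}, …, a_ℓ) = 1`. -/
def Rset {l : ℕ} (v : Fin l → Fin l → ℝ) (k : Fin l) : Set (Fin l → ℝ) :=
  {x | ∃ a : Fin l → ℤ, x = ∑ i, (a i : ℝ) • v i ∧
    Finset.gcd (Finset.univ.filter fun i => k ≤ i) a = 1}

/-- The ordered `ℤ`-basis `v` of `Λ` is reduced with respect to the norm `F`: for each `k`
one has `F(x) ≥ F(v_k)` for all `x ∈ R_k`. -/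
def IsReducedBasis {l : ℕ} (F : (Fin l → ℝ) → ℝ) (Λ : Set (Fin l → ℝ))
    (v : Fin l → Fin l → ℝ) : Prop :=
  IsZBasisOf v Λ ∧ ∀ k : Fin l, ∀ x ∈ Rset v k, F (v k) ≤ F x

/-- The `j`-th successive minimum (`j` = number of vectors) of a set `Λ ⊆ ℝ^ℓ` with
respect to a norm `F`: the infimum of all `μ > 0` such that there exist `j` linearly
independent vectors `v ∈ Λ` with `F(v) ≤ μ`. -/
noncomputable def succMin (l : ℕ) (F : (Fin l → ℝ) → ℝ) (Λ : Set (Fin l → ℝ)) (j : ℕ) : ℝ :=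
  sInf {μ : ℝ | 0 < μ ∧ ∃ v : Fin j → Fin l → ℝ,
    (∀ i, v i ∈ Λ) ∧ LinearIndependent ℝ v ∧ ∀ i, F (v i) ≤ μ}

theorem IsNorm.map_sum_le {l : ℕ} {F : (Fin l → ℝ) → ℝ} (hF : IsNorm F) {ι : Type*}
    (s : Finset ι) (f : ι → Fin l → ℝ) : F (∑ i ∈ s, f i) ≤ ∑ i ∈ s, F (f i) :=
  Finset.le_sum_of_subadditive F ((hF.2.1 0).2 rfl).le hF.2.2.2 s f

/-- Among the first `k + 1` of a linearly independent family of lattice vectors, some vector has a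
nonzero coordinate of index at least `k` with respect to `v`. -/
theorem IsZBasisOf.exists_coeff_ne_zero {l : ℕ} {Λ : Set (Fin l → ℝ)} {v w : Fin l → Fin l → ℝ}
    (hv : IsZBasisOf v Λ) (hw : ∀ i, w i ∈ Λ) (hwli : LinearIndependent ℝ w) (k : Fin l) :
    ∃ j ≤ k, ∃ a : Fin l → ℤ, w j = ∑ i, (a i : ℝ) • v i ∧ ∃ i, k ≤ i ∧ a i ≠ 0 := by
  by_contra! H
  have hmem : ∀ j : Set.Iic k, w j ∈ Submodule.span ℝ (Set.range fun i : Set.Iio k => v i) := by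
    rintro ⟨j, hj⟩
    have h := hw j
    rw [hv.2] at h
    obtain ⟨a, ha⟩ := h
    rw [ha]
    refine Submodule.sum_mem _ fun i _ => ?_
    rcases lt_or_ge i k with hi | hi
    · exact Submodule.smul_mem _ _ (Submodule.subset_span ⟨⟨i, hi⟩, rfl⟩)
    · simp [H j hj a ha i hi]
  have hli : LinearIndependent ℝ fun j : Set.Iic k => w j := hwli.comp _ Subtype.val_injective
  have hcard := linearIndependent_le_span_aux' _ hli (Set.range fun i : Set.Iio k => v i)
    (by rintro _ ⟨j, rfl⟩; exact hmem j)
  have hle := hcard.trans (Fintype.card_range_le _)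
  simp at hle

/-- A lattice vector with a nonzero coordinate of index at least `k` bounds the `k`-th vector of a
reduced basis, either directly or up to the average with the earlier basis vectors. -/
theorem IsReducedBasis.le_or_two_mul_le {l : ℕ} {F : (Fin l → ℝ) → ℝ} (hF : IsNorm F)
    {Λ : Set (Fin l → ℝ)} {v : Fin l → Fin l → ℝ} (hv : IsReducedBasis F Λ v) (k : Fin l)
    (a : Fin l → ℤ) (ha : ∃ i, k ≤ i ∧ a i ≠ 0) :
    F (v k) ≤ F (∑ i, (a i : ℝ) • v i) ∨
      2 * F (v k) ≤ F (∑ i, (a i : ℝ) • v i) + ∑ i ∈ Finset.Iio k, F (v i) := by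
  set S := Finset.univ.filter fun i => k ≤ i with hS
  obtain ⟨i₀, hi₀, hne⟩ := ha
  obtain ⟨b, hb, hb1⟩ := Finset.extract_gcd (s := S) a ⟨i₀, by simp [hS, hi₀]⟩
  set d := S.gcd a with hd
  have hd0 : d ≠ 0 := fun h => hne (Finset.gcd_eq_zero_iff.1 (hd ▸ h) i₀ (by simp [hS, hi₀]))
  have hdnn : 0 ≤ d := Int.nonneg_of_normalize_eq_self (hd ▸ Finset.normalize_gcd)
  rcases (by omega : d = 1 ∨ 2 ≤ d) with h1 | h2
  · exact Or.inl (hv.2 k _ ⟨a, rfl, h1⟩)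
  right
  have hd2 : (2 : ℝ) ≤ d := by exact_mod_cast h2
  have hdpos : (0 : ℝ) < d := by linarith
  set y := ∑ i, (a i : ℝ) • v i with hy
  let c : Fin l → ℤ := fun i => if k ≤ i then b i else round ((a i : ℝ) / d)
  have hc1 : S.gcd c = 1 := by
    rw [← hb1]
    exact Finset.gcd_congr rfl fun i hi => if_pos (by simpa [hS] using hi)
  have hx := hv.2 k _ ⟨c, rfl, hc1⟩
  have hdecomp : ∑ i, (c i : ℝ) • v i =
      (d : ℝ)⁻¹ • y + ∑ i ∈ Finset.Iio k, ((c i : ℝ) - a i / d) • v i := by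
    have hIio : Finset.Iio k = Finset.univ.filter fun i => i < k := by ext; simp
    rw [hy, Finset.smul_sum, hIio, Finset.sum_filter, ← Finset.sum_add_distrib]
    refine Finset.sum_congr rfl fun i _ => ?_
    split_ifs with hi
    · rw [smul_smul, ← add_smul]
      congr 1
      ring
    · have hki : k ≤ i := not_lt.1 hi
      have hai : (a i : ℝ) = d * b i := by exact_mod_cast hb i (by simp [hS, hki])
      have hci : c i = b i := if_pos hki
      rw [smul_smul, add_zero, hci, hai, inv_mul_cancel_left₀ hdpos.ne']
  have hterm : ∀ i ∈ Finset.Iio k, F (((c i : ℝ) - a i / d) • v i) ≤ 1 / 2 * F (v i) := by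
    intro i hi
    have hci : c i = round ((a i : ℝ) / d) := if_neg (not_le.2 (by simpa using hi))
    rw [hF.2.2.1, hci, abs_sub_comm]
    exact mul_le_mul_of_nonneg_right (abs_sub_round _) (hF.1 _)
  have hyle : F ((d : ℝ)⁻¹ • y) ≤ 1 / 2 * F y := by
    rw [hF.2.2.1, abs_of_pos (inv_pos.2 hdpos)]
    refine mul_le_mul_of_nonneg_right ?_ (hF.1 _)
    rw [inv_eq_one_div]
    gcongr
  have hsum := (hF.map_sum_le _ _).trans (Finset.sum_le_sum hterm)
  rw [← Finset.mul_sum] at hsum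
  have htri := hF.2.2.2 ((d : ℝ)⁻¹ • y) (∑ i ∈ Finset.Iio k, ((c i : ℝ) - a i / d) • v i)
  rw [hdecomp] at hx
  linarith

theorem one_add_sum_three_halves_pow_le (n : ℕ) :
    1 + ∑ i ∈ Finset.range n, (3 / 2 : ℝ) ^ (i - 1) ≤ 2 * (3 / 2 : ℝ) ^ (n - 1) := by
  induction n with
  | zero => norm_num
  | succ n ih =>
    rw [Finset.sum_range_succ]
    cases n with
    | zero => norm_num
    | succ m =>
      simp only [Nat.add_sub_cancel] at ih ⊢
      rw [pow_succ]
      linarith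

theorem IsZBasisOf.mem {l : ℕ} {Λ : Set (Fin l → ℝ)} {v : Fin l → Fin l → ℝ}
    (hv : IsZBasisOf v Λ) (k : Fin l) : v k ∈ Λ := by
  rw [hv.2]
  exact ⟨Pi.single k 1, by simp [Pi.single_apply, ite_smul]⟩

theorem succMin_one_le {l : ℕ} {F : (Fin l → ℝ) → ℝ} (hF : IsNorm F) {Λ : Set (Fin l → ℝ)}
    {x : Fin l → ℝ} (hx : x ∈ Λ) (hx0 : x ≠ 0) : succMin l F Λ 1 ≤ F x :=
  csInf_le ⟨0, fun _ h => h.1.le⟩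
    ⟨(hF.1 x).lt_of_ne fun h => hx0 ((hF.2.1 x).1 h.symm), fun _ => x, fun _ => hx,
      LinearIndependent.of_subsingleton 0 hx0, fun _ => le_rfl⟩

/-- Let `v₁, …, v_ℓ` be a reduced basis of a full-rank lattice `Λ ⊆ ℝ^ℓ` with respect to a
norm `F`, with `λ₁ ≤ ⋯ ≤ λ_ℓ` where `λ_i = F(v_i)`. If `w₁, …, w_ℓ ∈ Λ` are linearly
independent minimizing vectors for the successive minima `μ₁ ≤ ⋯ ≤ μ_ℓ` of `Λ` with
respect to `F`, then `λ₁ = μ₁` and `λ_k ≤ (3/2)^{k-2} μ_k` for `k = 2, …, ℓ` (indices here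
are 0-based, so the exponent is `k - 1`). -/
theorem reduced_basis_le_successive_minima {l : ℕ} (hl : 0 < l)
    (F : (Fin l → ℝ) → ℝ) (hF : IsNorm F)
    (Λ : Set (Fin l → ℝ)) (v : Fin l → Fin l → ℝ)
    (hv : IsReducedBasis F Λ v)
    (hvord : ∀ i j : Fin l, i ≤ j → F (v i) ≤ F (v j))
    (w : Fin l → Fin l → ℝ) (hw : ∀ i, w i ∈ Λ)
    (hwli : LinearIndependent ℝ w)
    (hwmin : ∀ j : Fin l, F (w j) = succMin l F Λ ((j : ℕ) + 1))
    (hword : ∀ i j : Fin l, i ≤ j → F (w i) ≤ F (w j)) :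
    F (v ⟨0, hl⟩) = F (w ⟨0, hl⟩) ∧
      ∀ k : Fin l, 1 ≤ (k : ℕ) → F (v k) ≤ (3 / 2 : ℝ) ^ ((k : ℕ) - 1) * F (w k) := by
  have hbound : ∀ (n : ℕ) (hn : n < l),
      F (v ⟨n, hn⟩) ≤ (3 / 2 : ℝ) ^ (n - 1) * F (w ⟨n, hn⟩) := by
    intro n
    induction n using Nat.strong_induction_on with
    | _ n ih =>
      intro hn
      set k : Fin l := ⟨n, hn⟩ with hk
      obtain ⟨j, hjk, a, haj, ha⟩ := hv.1.exists_coeff_ne_zero hw hwli k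
      have hpow : (1 : ℝ) ≤ (3 / 2 : ℝ) ^ (n - 1) := one_le_pow₀ (by norm_num)
      have hwj := hword j k hjk
      have hwk := hF.1 (w k)
      have hcases := hv.le_or_two_mul_le hF k a ha
      rw [← haj] at hcases
      rcases hcases with h | h
      · nlinarith
      · have hsum : ∑ i ∈ Finset.Iio k, F (v i) ≤
            (∑ i ∈ Finset.range n, (3 / 2 : ℝ) ^ (i - 1)) * F (w k) := by
          have hrange : ∑ i ∈ Finset.range n, (3 / 2 : ℝ) ^ (i - 1) =
              ∑ i ∈ Finset.Iio k, (3 / 2 : ℝ) ^ ((i : ℕ) - 1) := by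
            rw [← Nat.Iio_eq_range, show n = (k : ℕ) from rfl, ← Fin.map_valEmbedding_Iio,
              Finset.sum_map]
            rfl
          rw [hrange, Finset.sum_mul]
          refine Finset.sum_le_sum fun i hi => ?_
          have hik : i < k := by simpa using hi
          refine (ih i hik i.isLt).trans ?_
          gcongr
          exact hword i k hik.le
        have := mul_le_mul_of_nonneg_right (one_add_sum_three_halves_pow_le n) hwk
        linarith
  refine ⟨le_antisymm (by simpa using hbound 0 hl) ?_, fun k _ => hbound k k.isLt⟩
  rw [hwmin]
  exact succMin_one_le hF (hv.1.mem _) (hv.1.1.ne_zero _)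
end
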